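/- Let $K$ be a field and $n$ a positive integer such that either ($n\geq 4$ and $\mathrm{char}\,K\neq 3$) or $n\geq 5$. Then every exponential automorphism of the free metabelian Lie algebra $M_n$ of lower degree $\geq 5$ is tame. -/

import Mathlib

noncomputable section

/-- The free metabelian Lie algebra of rank `n` over `K`: the quotient of the free Lie
algebra on `n` generators by its second derived ideal. -/
abbrev FreeMetabelianLie (K : Type) [Field K] (n : ℕ) : Type :=
  FreeLieAlgebra K (Fin n) ⧸ LieAlgebra.derivedSeries K (FreeLieAlgebra K (Fin n)) 2

/-- The free generators `x₁, …, xₙ` of the free metabelian Lie algebra. -/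
def xg (K : Type) [Field K] (n : ℕ) (i : Fin n) : FreeMetabelianLie K n :=
  LieSubmodule.Quotient.mk (N := LieAlgebra.derivedSeries K (FreeLieAlgebra K (Fin n)) 2)
    (FreeLieAlgebra.of K i)

/-- The group structure on Lie algebra automorphisms, with `(e * f) x = e (f x)`. -/
instance lieAutGroup (K : Type) [CommRing K] (L : Type) [LieRing L] [LieAlgebra K L] :
    Group (L ≃ₗ⁅K⁆ L) where
  mul e f := f.trans e
  one := LieEquiv.refl
  inv := LieEquiv.symm
  mul_assoc _ _ _ := LieEquiv.ext fun _ => rfl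
  one_mul _ := LieEquiv.ext fun _ => rfl
  mul_one _ := LieEquiv.ext fun _ => rfl
  inv_mul_cancel e := LieEquiv.ext fun x => e.symm_apply_apply x

/-- An automorphism of the free metabelian Lie algebra is elementary if it maps some `xᵢ` to
`α • xᵢ + f`, with `0 ≠ α ∈ K` and `f` in the subalgebra generated by the other generators,
and fixes all other generators. -/
def IsElementaryAut (K : Type) [Field K] (n : ℕ)
    (φ : FreeMetabelianLie K n ≃ₗ⁅K⁆ FreeMetabelianLie K n) : Prop :=
  ∃ (i : Fin n) (α : K) (f : FreeMetabelianLie K n), α ≠ 0 ∧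
    f ∈ LieSubalgebra.lieSpan K (FreeMetabelianLie K n) (xg K n '' {j | j ≠ i}) ∧
    φ (xg K n i) = α • xg K n i + f ∧ ∀ j : Fin n, j ≠ i → φ (xg K n j) = xg K n j

/-- A tame automorphism is one in the subgroup generated by the elementary automorphisms. -/
def IsTame (K : Type) [Field K] (n : ℕ)
    (φ : FreeMetabelianLie K n ≃ₗ⁅K⁆ FreeMetabelianLie K n) : Prop :=
  φ ∈ Subgroup.closure {ψ | IsElementaryAut K n ψ}

/-- A Chein automorphism (one-row transformation) moves only one generator. -/
def IsCheinAut (K : Type) [Field K] (n : ℕ)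
    (φ : FreeMetabelianLie K n ≃ₗ⁅K⁆ FreeMetabelianLie K n) : Prop :=
  ∃ i : Fin n, ∀ j : Fin n, j ≠ i → φ (xg K n j) = xg K n j

/-- An almost tame automorphism is one in the subgroup generated by Chein automorphisms. -/
def IsAlmostTame (K : Type) [Field K] (n : ℕ)
    (φ : FreeMetabelianLie K n ≃ₗ⁅K⁆ FreeMetabelianLie K n) : Prop :=
  φ ∈ Subgroup.closure {ψ | IsCheinAut K n ψ}

/-- `monoSet K n k` is the set of right-normed Lie monomials of degree `k+1` in the
generators. -/
def monoSet (K : Type) [Field K] (n : ℕ) : ℕ → Set (FreeMetabelianLie K n)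
  | 0 => Set.range (xg K n)
  | k + 1 => {z | ∃ u ∈ monoSet K n k, ∃ i : Fin n, z = ⁅u, xg K n i⁆}

/-- `gradePiece K n k` (for `k ≥ 1`) is the homogeneous component `L_k` of the standard
grading: the linear span of the Lie monomials of degree `k` in the generators. -/
def gradePiece (K : Type) [Field K] (n : ℕ) (k : ℕ) : Submodule K (FreeMetabelianLie K n) :=
  Submodule.span K (monoSet K n (k - 1))

/-- The automorphism `φ = (l₁ + m₁, …, lₙ + mₙ)` (with `lᵢ` linear, `mᵢ ∈ [M,M]`) has lower
degree `≥ d`: each `φ(xᵢ)` lies in `L₁ ⊕ (⨆ k ≥ d, L_k)`. -/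
def AutLdegGE (K : Type) [Field K] (n : ℕ)
    (φ : FreeMetabelianLie K n ≃ₗ⁅K⁆ FreeMetabelianLie K n) (d : ℕ) : Prop :=
  ∀ i : Fin n, φ (xg K n i) ∈
    gradePiece K n 1 ⊔ ⨆ (k : ℕ) (_ : d ≤ k), gradePiece K n k

/-- The action of a polynomial `a ∈ U = K[y₁,…,yₙ]` on `m`; for `m ∈ [M,M]` this is the
canonical `U`-module action on the derived ideal, determined by `m ⬝ yᵢ = ⁅m, xᵢ⁆`. -/
def polyAct (K : Type) [Field K] (n : ℕ) (a : MvPolynomial (Fin n) K)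
    (m : FreeMetabelianLie K n) : FreeMetabelianLie K n :=
  ∑ d ∈ a.support, a.coeff d •
    ((List.ofFn fun i : Fin n =>
      (-(LieAlgebra.ad K (FreeMetabelianLie K n) (xg K n i))) ^ (d i)).prod m)

/-- The polynomial `a` has lower degree `≥ d`: every monomial of `a` has total degree `≥ d`. -/
def PolyLdegGE (K : Type) [Field K] (n : ℕ) (a : MvPolynomial (Fin n) K) (d : ℕ) : Prop :=
  ∀ v ∈ a.support, d ≤ ∑ i, v i

/-- An exponential automorphism: `exp (ad z) = id + ad z` for some `z ∈ [M,M]`. -/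
def IsExponentialAut (K : Type) [Field K] (n : ℕ)
    (φ : FreeMetabelianLie K n ≃ₗ⁅K⁆ FreeMetabelianLie K n) : Prop :=
  ∃ z ∈ LieAlgebra.derivedSeries K (FreeMetabelianLie K n) 1,
    ∀ m : FreeMetabelianLie K n, φ m = m + ⁅z, m⁆

end

noncomputable section

open MvPolynomial
open scoped IsMulCommutative

/-- Evaluation of polynomials at a family of commuting elements of an algebra. -/
def MvPolynomial.aevalOfComm {K A σ : Type*} [CommRing K] [Ring A] [Algebra K A] (g : σ → A)
    (hg : ∀ i j, g i * g j = g j * g i) : MvPolynomial σ K →ₐ[K] A :=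
  haveI : IsMulCommutative (Algebra.adjoin K (Set.range g)) :=
    Algebra.isMulCommutative_adjoin K (by rintro _ ⟨i, rfl⟩ _ ⟨j, rfl⟩; exact hg i j)
  letI : CommRing (Algebra.adjoin K (Set.range g)) := inferInstance
  (Subalgebra.val _).comp (aeval fun i => ⟨g i, Algebra.subset_adjoin ⟨i, rfl⟩⟩ :
    MvPolynomial σ K →ₐ[K] Algebra.adjoin K (Set.range g))

theorem MvPolynomial.aevalOfComm_X {K A σ : Type*} [CommRing K] [Ring A] [Algebra K A] (g : σ → A)
    (hg : ∀ i j, g i * g j = g j * g i) (i : σ) :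
    aevalOfComm g hg (X i : MvPolynomial σ K) = g i :=
  haveI : IsMulCommutative (Algebra.adjoin K (Set.range g)) :=
    Algebra.isMulCommutative_adjoin K (by rintro _ ⟨i, rfl⟩ _ ⟨j, rfl⟩; exact hg i j)
  letI : CommRing (Algebra.adjoin K (Set.range g)) := inferInstance
  congrArg Subtype.val (aeval_X (R := K)
    (fun i => (⟨g i, Algebra.subset_adjoin ⟨i, rfl⟩⟩ : Algebra.adjoin K (Set.range g))) i)

/-- Induction principle for the derived ideal of a Lie algebra. -/
theorem LieAlgebra.derivedSeries_one_induction {K L : Type*} [CommRing K] [LieRing L]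
    [LieAlgebra K L] {p : L → Prop} (lie : ∀ a b : L, p ⁅a, b⁆) (zero : p 0)
    (add : ∀ a b, p a → p b → p (a + b)) {z : L} (hz : z ∈ LieAlgebra.derivedSeries K L 1) :
    p z := by
  rw [← LieSubmodule.mem_toSubmodule, LieAlgebra.derivedSeries_def,
    LieAlgebra.derivedSeriesOfIdeal_succ, LieSubmodule.lieIdeal_oper_eq_linear_span'] at hz
  have : ∀ c : K, p (c • z) := by
    induction hz using Submodule.span_induction with
    | mem x hx => obtain ⟨a, -, b, -, rfl⟩ := hx; intro c; rw [← smul_lie]; exact lie _ _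
    | zero => simpa using zero
    | add x y _ _ hx hy => intro c; rw [smul_add]; exact add _ _ (hx c) (hy c)
    | smul c x _ hx => intro c'; rw [smul_smul]; exact hx _
  simpa using this 1

/-- A Lie homomorphism from a Lie algebra to a metabelian one kills the second derived ideal. -/
theorem LieHom.map_derivedSeries_two_eq_zero {K L L' : Type*} [CommRing K] [LieRing L]
    [LieAlgebra K L] [LieRing L'] [LieAlgebra K L'] (f : L →ₗ⁅K⁆ L')
    (hL' : ∀ a b c d : L', ⁅⁅a, b⁆, ⁅c, d⁆⁆ = 0) {z : L}
    (hz : z ∈ LieAlgebra.derivedSeries K L 2) : f z = 0 := by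
  have h1 : ∀ w ∈ LieAlgebra.derivedSeries K L 1, ∀ c d : L', ⁅f w, ⁅c, d⁆⁆ = 0 := fun w hw c d =>
    LieAlgebra.derivedSeries_one_induction (p := fun w => ⁅f w, ⁅c, d⁆⁆ = 0)
      (fun a b => by rw [LieHom.map_lie, hL']) (by simp)
      (fun x y hx hy => by rw [map_add, add_lie, hx, hy, add_zero]) hw
  have h2 : ∀ u ∈ LieAlgebra.derivedSeries K L 1, ∀ w ∈ LieAlgebra.derivedSeries K L 1,
      ⁅f u, f w⁆ = 0 := fun u hu w hw =>
    LieAlgebra.derivedSeries_one_induction (p := fun w => ⁅f u, f w⁆ = 0)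
      (fun a b => by rw [LieHom.map_lie, h1 u hu]) (by simp)
      (fun x y hx hy => by rw [map_add, lie_add, hx, hy, add_zero]) hw
  rw [← LieSubmodule.mem_toSubmodule, LieAlgebra.derivedSeries_def,
    LieAlgebra.derivedSeriesOfIdeal_succ, LieSubmodule.lieIdeal_oper_eq_linear_span'] at hz
  induction hz using Submodule.span_induction with
  | mem x hx =>
    obtain ⟨a, ha, b, hb, rfl⟩ := hx
    rw [LieHom.map_lie]
    exact h2 a ha b hb
  | zero => simp
  | add x y _ _ hx hy => rw [map_add, hx, hy, add_zero]
  | smul c x _ hx => rw [map_smul, hx, smul_zero]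

namespace FreeMetabelianLie

variable {K : Type} [Field K] {n : ℕ}

local notation "M" => FreeMetabelianLie K n
local notation "U" => MvPolynomial (Fin n) K

theorem mk_surjective (x : M) : ∃ y, LieSubmodule.Quotient.mk
    (N := LieAlgebra.derivedSeries K (FreeLieAlgebra K (Fin n)) 2) y = x :=
  Quot.mk_surjective x

theorem lie_lie_lie (a b c d : M) : ⁅⁅a, b⁆, ⁅c, d⁆⁆ = 0 := by
  obtain ⟨a, rfl⟩ := mk_surjective a
  obtain ⟨b, rfl⟩ := mk_surjective b
  obtain ⟨c, rfl⟩ := mk_surjective c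
  obtain ⟨d, rfl⟩ := mk_surjective d
  simp only [← LieSubmodule.Quotient.mk_bracket]
  refine LieSubmodule.Quotient.mk_eq_zero'.2 ?_
  have h (u v : FreeLieAlgebra K (Fin n)) :
      ⁅u, v⁆ ∈ LieAlgebra.derivedSeries K (FreeLieAlgebra K (Fin n)) 1 :=
    LieSubmodule.lie_mem_lie (LieSubmodule.mem_top _) (LieSubmodule.mem_top _)
  exact LieSubmodule.lie_mem_lie (h a b) (h c d)

/-- The universal property of the free metabelian Lie algebra. -/
def lift {L : Type} [LieRing L] [LieAlgebra K L] (hL : ∀ a b c d : L, ⁅⁅a, b⁆, ⁅c, d⁆⁆ = 0)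
    (g : Fin n → L) : M →ₗ⁅K⁆ L where
  toLinearMap := Submodule.liftQ _ (FreeLieAlgebra.lift K g : FreeLieAlgebra K (Fin n) →ₗ[K] L)
    fun _ hz => LieHom.map_derivedSeries_two_eq_zero _ hL hz
  map_lie' {x y} := by
    obtain ⟨x, rfl⟩ := mk_surjective x
    obtain ⟨y, rfl⟩ := mk_surjective y
    exact LieHom.map_lie (FreeLieAlgebra.lift K g) x y

@[simp]
theorem lift_xg {L : Type} [LieRing L] [LieAlgebra K L]
    (hL : ∀ a b c d : L, ⁅⁅a, b⁆, ⁅c, d⁆⁆ = 0) (g : Fin n → L) (i : Fin n) :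
    lift hL g (xg K n i) = g i :=
  FreeLieAlgebra.lift_of_apply g i

theorem hom_ext {L : Type} [LieRing L] [LieAlgebra K L] {f g : M →ₗ⁅K⁆ L}
    (h : ∀ i, f (xg K n i) = g (xg K n i)) : f = g := by
  let p : FreeLieAlgebra K (Fin n) →ₗ⁅K⁆ M :=
    { Submodule.mkQ (LieAlgebra.derivedSeries K (FreeLieAlgebra K (Fin n)) 2).toSubmodule with
      map_lie' := fun {_ _} => rfl }
  have h' : f.comp p = g.comp p := FreeLieAlgebra.hom_ext h
  ext x
  obtain ⟨x, rfl⟩ := mk_surjective x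
  exact LieHom.congr_fun h' x

theorem lieSpan_range_xg : LieSubalgebra.lieSpan K M (Set.range (xg K n)) = ⊤ := by
  set S := LieSubalgebra.lieSpan K M (Set.range (xg K n))
  let f : M →ₗ⁅K⁆ S := lift (fun a b c d => Subtype.ext (lie_lie_lie (a : M) b c d))
    fun i => ⟨xg K n i, LieSubalgebra.subset_lieSpan ⟨i, rfl⟩⟩
  have h : S.incl.comp f = LieHom.id := hom_ext fun i => by simp [f]
  refine eq_top_iff.2 fun x _ => ?_
  have := LieHom.congr_fun h x
  simp only [LieHom.comp_apply, LieHom.id_apply] at this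
  rw [← this]
  exact (f x).2

variable (K n) in
/-- The derived ideal of the free metabelian Lie algebra. -/
abbrev Der : LieIdeal K (FreeMetabelianLie K n) :=
  LieAlgebra.derivedSeries K (FreeMetabelianLie K n) 1

local notation "D" => Der K n

theorem lie_mem_der (a b : M) : ⁅a, b⁆ ∈ D :=
  LieSubmodule.lie_mem_lie (LieSubmodule.mem_top _) (LieSubmodule.mem_top _)

theorem lie_der_der {a b : M} (ha : a ∈ D) (hb : b ∈ D) : ⁅a, b⁆ = 0 := by
  refine LieAlgebra.derivedSeries_one_induction (p := fun a => ⁅a, b⁆ = 0) (fun c d => ?_)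
    (zero_lie b) (fun x y hx hy => by rw [add_lie, hx, hy, add_zero]) ha
  exact LieAlgebra.derivedSeries_one_induction (p := fun b => ⁅⁅c, d⁆, b⁆ = 0)
    (lie_lie_lie c d) (lie_zero _) (fun x y hx hy => by rw [lie_add, hx, hy, add_zero]) hb

theorem hom_mem_der (f : M →ₗ⁅K⁆ M) {z : M} (hz : z ∈ D) : f z ∈ D :=
  LieAlgebra.derivedSeries_one_induction (p := fun z => f z ∈ D)
    (fun a b => by rw [LieHom.map_lie]; exact lie_mem_der _ _) (by simp)
    (fun x y hx hy => by rw [map_add]; exact add_mem hx hy) hz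

/-- The operator `z ↦ ⁅z, x⁆` on the derived ideal. -/
def rad (x : M) : Module.End K D where
  toFun z := ⟨⁅(z : M), x⁆, lie_mem_der _ _⟩
  map_add' a b := Subtype.ext (add_lie (a : M) b x)
  map_smul' c a := Subtype.ext (smul_lie c (a : M) x)

theorem rad_comm (x y : M) : rad x * rad y = rad y * rad x := by
  ext z
  change ⁅⁅(z : M), y⁆, x⁆ = ⁅⁅(z : M), x⁆, y⁆
  have h : ⁅(z : M), ⁅x, y⁆⁆ = 0 := lie_der_der z.2 (lie_mem_der x y)
  rw [leibniz_lie, ← lie_skew x, add_neg_eq_zero] at h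
  exact h.symm

/-- The polynomial ring acts on the derived ideal, with `X i` acting as `z ↦ ⁅z, xᵢ⁆`. -/
def polyHom : U →ₐ[K] Module.End K D :=
  MvPolynomial.aevalOfComm (fun i => rad (xg K n i)) fun _ _ => rad_comm _ _

theorem polyHom_X (i : Fin n) : polyHom (X i : MvPolynomial (Fin n) K) = rad (xg K n i) :=
  MvPolynomial.aevalOfComm_X _ _ i

instance : Module U D := Module.compHom _ (polyHom : U →ₐ[K] Module.End K D).toRingHom

theorem smul_def (q : U) (z : D) : q • z = polyHom q z := rfl

instance : IsScalarTower K U D := ⟨fun c q z => by simp [smul_def]⟩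

theorem coe_X_smul (i : Fin n) (z : D) : (((X i : U) • z : D) : M) = ⁅(z : M), xg K n i⁆ := by
  rw [smul_def, polyHom_X]; rfl

theorem C_smul (c : K) (z : D) : (C c : U) • z = c • z := by
  rw [← algebraMap_eq, algebraMap_smul]

theorem lie_add_right_of_mem (z w : D) (a : M) : ⁅(z : M), a + w⁆ = ⁅(z : M), a⁆ := by
  rw [lie_add, lie_der_der z.2 w.2, add_zero]

/-- The element `⁅xᵢ, xⱼ⁆` of the derived ideal. -/
def brk (i j : Fin n) : D := ⟨⁅xg K n i, xg K n j⁆, lie_mem_der _ _⟩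

theorem coe_brk (i j : Fin n) : ((brk i j : D) : M) = ⁅xg K n i, xg K n j⁆ := rfl

@[simp]
theorem brk_self (i : Fin n) : (brk i i : D) = 0 := Subtype.ext (lie_self _)

theorem brk_skew (i j : Fin n) : (brk i j : D) = -brk j i := Subtype.ext (lie_skew _ _).symm

theorem brk_jacobi (i j k : Fin n) :
    (X k : U) • (brk i j : D) + (X i : U) • (brk j k : D) + (X j : U) • (brk k i : D) = 0 := by
  apply Subtype.ext
  simp only [LieSubmodule.coe_add, coe_X_smul, coe_brk, LieSubmodule.coe_zero]
  rw [← lie_skew ⁅_, _⁆ (xg K n k), ← lie_skew ⁅_, _⁆ (xg K n i), ← lie_skew ⁅_, _⁆ (xg K n j),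
    ← neg_add, ← neg_add, neg_eq_zero, ← lie_jacobi (xg K n i) (xg K n j) (xg K n k)]
  abel

theorem span_brk :
    Submodule.span U (Set.range fun p : Fin n × Fin n => (brk p.1 p.2 : D)) = ⊤ := by
  let N : Submodule K M :=
    ((Submodule.span U (Set.range fun p : Fin n × Fin n =>
      (brk p.1 p.2 : D))).restrictScalars K).map (LieSubmodule.incl D : D →ₗ[K] M)
  have hbrk (i j : Fin n) : ⁅xg K n i, xg K n j⁆ ∈ N :=
    ⟨brk i j, Submodule.subset_span ⟨(i, j), rfl⟩, rfl⟩
  have hX (i : Fin n) {w : M} (hw : w ∈ N) : ⁅w, xg K n i⁆ ∈ N := by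
    obtain ⟨w, hw, rfl⟩ := hw
    exact ⟨(X i : U) • w, Submodule.smul_mem (Submodule.span U _) _ hw, coe_X_smul i w⟩
  have hN {w : M} (hw : w ∈ N) : w ∈ D := by
    obtain ⟨w, -, rfl⟩ := hw
    exact w.2
  have hP (a b : M) (ha : a ∈ Submodule.span K (Set.range (xg K n)) ⊔ N)
      (hb : b ∈ Submodule.span K (Set.range (xg K n)) ⊔ N) : ⁅a, b⁆ ∈ N := by
    obtain ⟨a, ha₁, a', ha', rfl⟩ := Submodule.mem_sup.1 ha
    obtain ⟨b, hb₁, b', hb', rfl⟩ := Submodule.mem_sup.1 hb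
    clear ha hb
    rw [add_lie, lie_add, lie_add, lie_der_der (hN ha') (hN hb'), add_zero]
    have h (a a' : M) (ha : a ∈ Submodule.span K (Set.range (xg K n))) (ha' : a' ∈ N) :
        ⁅a', a⁆ ∈ N := by
      induction ha using Submodule.span_induction with
      | mem x hx => obtain ⟨i, rfl⟩ := hx; exact hX i ha'
      | zero => simp
      | add x y _ _ hx hy => rw [lie_add]; exact add_mem hx hy
      | smul c x _ hx => rw [lie_smul]; exact Submodule.smul_mem _ _ hx
    refine add_mem (add_mem ?_ ?_) (h _ _ hb₁ ha')
    · induction ha₁ using Submodule.span_induction with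
      | mem x hx =>
        obtain ⟨i, rfl⟩ := hx
        induction hb₁ using Submodule.span_induction with
        | mem x hx => obtain ⟨j, rfl⟩ := hx; exact hbrk i j
        | zero => simp
        | add x y _ _ hx hy => rw [lie_add]; exact add_mem hx hy
        | smul c x _ hx => rw [lie_smul]; exact Submodule.smul_mem _ _ hx
      | zero => simp
      | add x y _ _ hx hy => rw [add_lie]; exact add_mem hx hy
      | smul c x _ hx => rw [smul_lie]; exact Submodule.smul_mem _ _ hx
    · rw [← lie_skew]; exact neg_mem (h _ _ ha₁ hb')
  have hM (a : M) : a ∈ Submodule.span K (Set.range (xg K n)) ⊔ N := by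
    let S : LieSubalgebra K M :=
      { Submodule.span K (Set.range (xg K n)) ⊔ N with
        lie_mem' := fun {a b} ha hb => Submodule.mem_sup_right (hP a b ha hb) }
    have : (⊤ : LieSubalgebra K M) ≤ S := by
      rw [← lieSpan_range_xg, LieSubalgebra.lieSpan_le]
      exact fun x hx => Submodule.mem_sup_left (Submodule.subset_span hx)
    exact this (LieSubalgebra.mem_top a)
  have hD (w : M) (hw : w ∈ D) : w ∈ N :=
    LieAlgebra.derivedSeries_one_induction (p := fun w => w ∈ N)
      (fun a b => hP a b (hM a) (hM b)) (zero_mem N) (fun _ _ => add_mem) hw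
  refine eq_top_iff.2 fun w _ => ?_
  obtain ⟨w', hw', h⟩ := hD w w.2
  rwa [← Subtype.ext h]

/-- The restriction of an endomorphism to the derived ideal. -/
def restrictDer (f : M →ₗ⁅K⁆ M) : D →ₗ[K] D where
  toFun z := ⟨f z, hom_mem_der f z.2⟩
  map_add' _ _ := Subtype.ext (map_add f _ _)
  map_smul' c _ := Subtype.ext (map_smul f c _)

theorem coe_restrictDer (f : M →ₗ⁅K⁆ M) (z : D) : (restrictDer f z : M) = f z := rfl

/-- An endomorphism acts semilinearly on the derived ideal. -/
theorem restrictDer_smul (f : M →ₗ⁅K⁆ M) (σ : U →ₐ[K] U)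
    (h : ∀ (i : Fin n) (z : D), (⁅(z : M), f (xg K n i)⁆ : M) = (σ (X i) • z : D)) (q : U) (z : D) :
    restrictDer f (q • z) = σ q • restrictDer f z := by
  induction q using MvPolynomial.induction_on generalizing z with
  | C c => rw [← algebraMap_eq, AlgHom.commutes, algebraMap_smul, algebraMap_smul, map_smul]
  | add p q hp hq => rw [add_smul, map_add, hp, hq, map_add, add_smul]
  | mul_X p i hp =>
    rw [mul_smul, hp, map_mul, mul_smul]
    congr 1
    apply Subtype.ext
    rw [coe_restrictDer, coe_X_smul, LieHom.map_lie, ← h i, coe_restrictDer]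

/-- The endomorphism `xᵢ ↦ xᵢ + mᵢ` with all `mᵢ` in the derived ideal. -/
def ia (m : Fin n → D) : M →ₗ⁅K⁆ M := lift lie_lie_lie fun i => xg K n i + m i

@[simp]
theorem ia_xg (m : Fin n → D) (i : Fin n) : ia m (xg K n i) = xg K n i + m i := lift_xg _ _ i

/-- The action of `ia m` on the derived ideal. -/
def iaDer (m : Fin n → D) : D →ₗ[U] D where
  __ := restrictDer (ia m)
  map_smul' q z := restrictDer_smul _ (AlgHom.id K U)
    (fun i z => by rw [ia_xg, lie_add_right_of_mem, ← coe_X_smul]; rfl) q z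

theorem coe_iaDer (m : Fin n → D) (z : D) : (iaDer m z : M) = ia m z := rfl

@[simp]
theorem iaDer_brk (m : Fin n → D) (i j : Fin n) :
    iaDer m (brk i j) = brk i j + (X j : U) • m i - (X i : U) • m j := by
  apply Subtype.ext
  rw [coe_iaDer, coe_brk, LieHom.map_lie, ia_xg, ia_xg, lie_add, add_lie, add_lie,
    ← lie_skew (xg K n i) (m j : M),
    lie_der_der (m i).2 (m j).2, ← coe_X_smul, ← coe_X_smul]
  simp only [LieSubmodule.coe_add, LieSubmodule.coe_sub, coe_brk]
  abel

/-- A tuple `m` of elements of the derived ideal is tame if `xᵢ ↦ xᵢ + mᵢ` is a tame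
automorphism. -/
def TameTuple (m : Fin n → D) : Prop := ∃ φ : M ≃ₗ⁅K⁆ M, IsTame K n φ ∧ ∀ x, φ x = ia m x

theorem TameTuple.comp {m m' : Fin n → D} (hm : TameTuple m) (hm' : TameTuple m') :
    TameTuple (m + iaDer m ∘ m') := by
  obtain ⟨φ, hφ, h⟩ := hm
  obtain ⟨ψ, hψ, h'⟩ := hm'
  refine ⟨φ * ψ, mul_mem hφ hψ, fun x => ?_⟩
  have : (ia m).comp (ia m') = ia (m + iaDer m ∘ m') := hom_ext fun i => by
    simp [coe_iaDer, add_assoc]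
  rw [← this, LieHom.comp_apply, ← h', ← h]
  rfl

theorem isTame_of_tameTuple {m : Fin n → D} (hm : TameTuple m) (φ : M ≃ₗ⁅K⁆ M)
    (h : ∀ i, φ (xg K n i) = xg K n i + m i) : IsTame K n φ := by
  obtain ⟨ψ, hψ, h'⟩ := hm
  have : (φ : M →ₗ⁅K⁆ M) = ψ := hom_ext fun i => by
    simp [h, h']
  have : φ = ψ := LieEquiv.ext fun x => LieHom.congr_fun this x
  exact this ▸ hψ

/-- The subalgebra generated by all generators but `xᵢ`. -/
abbrev without (i : Fin n) : LieSubalgebra K M := LieSubalgebra.lieSpan K M (xg K n '' {j | j ≠ i})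

theorem hom_eq_self_of_mem_without {f : M →ₗ⁅K⁆ M} {i : Fin n}
    (hf : ∀ j, j ≠ i → f (xg K n j) = xg K n j) {a : M} (ha : a ∈ without i) : f a = a := by
  induction ha using LieSubalgebra.lieSpan_induction with
  | mem x hx => obtain ⟨j, hj, rfl⟩ := hx; exact hf j hj
  | zero => simp
  | add x y _ _ hx hy => rw [map_add, hx, hy]
  | smul c x _ hx => rw [map_smul, hx]
  | lie x y _ _ hx hy => rw [LieHom.map_lie, hx, hy]

theorem exists_isTame_add (i : Fin n) {a : M} (ha : a ∈ without i) :
    ∃ φ : M ≃ₗ⁅K⁆ M, IsTame K n φ ∧ φ (xg K n i) = xg K n i + a ∧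
      φ.symm (xg K n i) = xg K n i - a ∧
      ∀ j, j ≠ i → φ (xg K n j) = xg K n j ∧ φ.symm (xg K n j) = xg K n j := by
  let f (b : M) : M →ₗ⁅K⁆ M :=
    lift lie_lie_lie fun j => if j = i then xg K n i + b else xg K n j
  have hne (b : M) (j : Fin n) (hj : j ≠ i) : f b (xg K n j) = xg K n j := by simp [f, hj]
  have heq (b : M) : f b (xg K n i) = xg K n i + b := by simp [f]
  have hc (b c : M) (hc : c ∈ without i) (hbc : b + c = 0) : (f b).comp (f c) = LieHom.id := by
    refine hom_ext fun j => ?_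
    rw [LieHom.comp_apply]
    by_cases hj : j = i
    · rw [hj, heq, map_add, heq, hom_eq_self_of_mem_without (hne b) hc, add_assoc, hbc, add_zero]
      rfl
    · rw [hne _ _ hj, hne _ _ hj]
      rfl
  let φ : M ≃ₗ⁅K⁆ M :=
    { f a with
      invFun := f (-a)
      left_inv := LieHom.congr_fun (hc (-a) a ha (neg_add_cancel a))
      right_inv := LieHom.congr_fun (hc a (-a) (neg_mem ha) (add_neg_cancel a)) }
  refine ⟨φ, Subgroup.subset_closure ⟨i, 1, a, one_ne_zero, ha, ?_, hne a⟩, heq a, ?_,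
    fun j hj => ⟨hne a j hj, hne (-a) j hj⟩⟩
  · rw [one_smul]; exact heq a
  · rw [sub_eq_add_neg]; exact heq (-a)

theorem smul_mem_without {i : Fin n} {q : U} (hq : q ∈ supported K {i}ᶜ) {z : D}
    (hz : (z : M) ∈ without i) : ((q • z : D) : M) ∈ without i := by
  rw [supported] at hq
  induction hq using Algebra.adjoin_induction generalizing z with
  | mem x hx =>
    obtain ⟨j, hj, rfl⟩ := hx
    rw [coe_X_smul]
    exact LieSubalgebra.lie_mem _ hz (LieSubalgebra.subset_lieSpan ⟨j, hj, rfl⟩)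
  | algebraMap c => rw [algebraMap_smul]; exact (without i).smul_mem c hz
  | add p q _ _ hp hq => rw [add_smul]; exact add_mem (hp hz) (hq hz)
  | mul p q _ _ hp hq => rw [mul_smul]; exact hp (hq hz)

theorem brk_mem_without {i j k : Fin n} (hj : j ≠ i) (hk : k ≠ i) :
    ((brk j k : D) : M) ∈ without i :=
  LieSubalgebra.lie_mem _ (LieSubalgebra.subset_lieSpan ⟨j, hj, rfl⟩)
    (LieSubalgebra.subset_lieSpan ⟨k, hk, rfl⟩)

theorem tameTuple_single {i j k : Fin n} (hj : j ≠ i) (hk : k ≠ i) {q : U}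
    (hq : q ∈ supported K {i}ᶜ) : TameTuple (Pi.single i (q • brk j k : D)) := by
  obtain ⟨φ, hφ, h1, -, h2⟩ := exists_isTame_add i (smul_mem_without hq (brk_mem_without hj hk))
  refine ⟨φ, hφ, fun x => ?_⟩
  have : (φ : M →ₗ⁅K⁆ M) = ia (Pi.single i (q • brk j k : D)) := hom_ext fun l => by
    rcases eq_or_ne l i with rfl | hl
    · simp [h1]
    · simp [h2 l hl, hl]
  exact LieHom.congr_fun this x

theorem iaDer_comp_single (m : Fin n → D) (i : Fin n) (z : D) :
    iaDer m ∘ Pi.single i z = Pi.single i (iaDer m z) := by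
  funext j
  rcases eq_or_ne j i with rfl | hj
  · simp
  · simp [hj]

theorem TameTuple.add_single {i : Fin n} {f g : D} (hf : TameTuple (Pi.single i f))
    (hg : TameTuple (Pi.single i g)) (hfg : iaDer (Pi.single i f) g = g) :
    TameTuple (Pi.single i (f + g) : Fin n → D) := by
  have := hf.comp hg
  rwa [iaDer_comp_single, hfg, ← Pi.single_add] at this

theorem tameTuple_single_mul {i l j k p : Fin n} (hli : l ≠ i) (hji : j ≠ i) (hki : k ≠ i)
    (hpi : p ≠ i) (hjl : j ≠ l) (hkl : k ≠ l) (hpl : p ≠ l) {q' q'' : U}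
    (hq' : q' ∈ supported K {l}ᶜ) (hq'' : q'' ∈ supported K {i}ᶜ) :
    TameTuple (Pi.single i ((q' * q'') • (X p : U) • brk j k : D)) := by
  set t : D := q' • brk j k with ht
  set s : D := q'' • brk l p with hs
  have h1 := (tameTuple_single (n := n) hjl hkl hq').comp (tameTuple_single hli hpi hq'')
  have e1 : iaDer (Pi.single l t) s = s + (q'' * X p) • t := by
    simp only [hs, map_smul, iaDer_brk, Pi.single_eq_same, Pi.single_eq_of_ne hpl]
    module
  rw [← hs, ← ht, iaDer_comp_single, e1] at h1
  have h2 := h1.comp (tameTuple_single (n := n) hjl hkl (neg_mem hq'))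
  have e2 : iaDer (Pi.single l t + Pi.single i (s + (q'' * X p) • t)) (-q' • brk j k) = -t := by
    simp only [ht, map_smul, iaDer_brk, Pi.add_apply, Pi.single_eq_of_ne hjl,
      Pi.single_eq_of_ne hkl, Pi.single_eq_of_ne hji, Pi.single_eq_of_ne hki]
    module
  rw [iaDer_comp_single, e2, add_right_comm, ← Pi.single_add, add_neg_cancel, Pi.single_zero,
    zero_add] at h2
  have h3 := h2.add_single (tameTuple_single (n := n) hli hpi (neg_mem hq'')) (by
    simp [hli, hpi])
  convert h3 using 2
  rw [hs, ht]
  module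

theorem tameTuple_single_X {i l j k p : Fin n} (hli : l ≠ i) (hji : j ≠ i) (hki : k ≠ i)
    (hpi : p ≠ i) (hjl : j ≠ l) (hkl : k ≠ l) (hpl : p ≠ l) (q : U) :
    TameTuple (Pi.single i (q • (X p : U) • brk j k : D)) := by
  induction q using MvPolynomial.induction_on' with
  | monomial v c =>
    have hv : monomial v c = X i ^ v i * monomial (v.erase i) c := by
      rw [X_pow_eq_monomial, monomial_mul, one_mul, Finsupp.single_add_erase]
    rw [hv]
    refine tameTuple_single_mul hli hji hki hpi hjl hkl hpl
      (pow_mem (X_mem_supported.2 hli.symm) _) ?_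
    rw [mem_supported]
    intro a ha
    rcases eq_or_ne c 0 with rfl | hc
    · simp at ha
    · rw [Finset.mem_coe, vars_monomial hc, Finsupp.support_erase] at ha
      exact Finset.ne_of_mem_erase ha
  | add p q hp hq =>
    rw [add_smul]
    exact hp.add_single hq (by simp [hji, hki])

/-- The transvection `xⱼ ↦ xⱼ + xₗ`. -/
def transv (j l : Fin n) : M →ₗ⁅K⁆ M :=
  lift lie_lie_lie fun k => xg K n k + if k = j then xg K n l else 0

/-- The action of the transvection `xⱼ ↦ xⱼ + xₗ` on polynomials. -/
def transvPoly (j l : Fin n) : U →ₐ[K] U := aeval fun k => X k + if k = j then X l else 0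

theorem transvPoly_surjective {j l : Fin n} (h : l ≠ j) :
    Function.Surjective (transvPoly j l : U →ₐ[K] U) := by
  let τ : U →ₐ[K] U := aeval fun k => X k - if k = j then X l else 0
  have : (transvPoly j l).comp τ = AlgHom.id K U := algHom_ext fun k => by
    by_cases hk : k = j <;> simp [τ, transvPoly, hk, h]
  exact fun q => ⟨τ q, AlgHom.congr_fun this q⟩

theorem transv_smul {j l : Fin n} (q : U) (z : D) :
    restrictDer (transv j l) (q • z) = transvPoly j l q • restrictDer (transv j l) z := by
  refine restrictDer_smul _ _ (fun i z => ?_) q z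
  rw [transv, lift_xg, transvPoly, aeval_X, lie_add, add_smul, LieSubmodule.coe_add, coe_X_smul]
  congr 1
  split_ifs
  · rw [coe_X_smul]
  · simp

theorem transv_brk_of_ne {j l a b : Fin n} (ha : a ≠ j) (hb : b ≠ j) :
    restrictDer (transv j l) (brk a b) = (brk a b : D) := by
  apply Subtype.ext
  simp [coe_restrictDer, coe_brk, transv, ha, hb]

theorem transv_brk {j l b : Fin n} (hb : b ≠ j) :
    restrictDer (transv j l) (brk j b) = (brk j b + brk l b : D) := by
  apply Subtype.ext
  simp [coe_restrictDer, coe_brk, transv, hb]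

theorem TameTuple.conj_transv {j l : Fin n} (h : l ≠ j) {m : Fin n → D} (hm : TameTuple m) :
    TameTuple fun k => restrictDer (transv j l) (m k - if k = j then m l else 0) := by
  obtain ⟨φ, hφ, h1⟩ := hm
  obtain ⟨ψ, hψ, h2, h3, h4⟩ := exists_isTame_add j
    (LieSubalgebra.subset_lieSpan (R := K) ⟨l, h, rfl⟩ : xg K n l ∈ without j)
  have hψ' : (ψ : M →ₗ⁅K⁆ M) = transv j l := hom_ext fun k => by
    rcases eq_or_ne k j with rfl | hk
    · simp [transv, h2]
    · simp [transv, h4 k hk, hk]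
  have hψ'' (x : M) : ψ x = transv j l x := LieHom.congr_fun hψ' x
  refine ⟨ψ * φ * ψ⁻¹, mul_mem (mul_mem hψ hφ) (inv_mem hψ), fun x => ?_⟩
  refine LieHom.congr_fun (f := ((ψ * φ * ψ⁻¹ : M ≃ₗ⁅K⁆ M) : M →ₗ⁅K⁆ M)) (hom_ext fun k => ?_) x
  change ψ (φ (ψ.symm (xg K n k))) = _
  rcases eq_or_ne k j with rfl | hk
  · rw [h3, map_sub, h1, h1, ia_xg, ia_xg, ia_xg, if_pos rfl, coe_restrictDer, ← hψ'',
      LieSubmodule.coe_sub, map_sub, map_add, map_add, map_sub, h2, (h4 l h).1]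
    abel
  · rw [(h4 k hk).2, h1, ia_xg, ia_xg, if_neg hk, sub_zero, coe_restrictDer, ← hψ'', map_add,
      (h4 k hk).1]

theorem TameTuple.conj_transv_single {i j l : Fin n} (h : l ≠ j) (hj : j ≠ i) (hl : l ≠ i) {z : D}
    (hz : TameTuple (Pi.single i z)) :
    TameTuple (Pi.single i (restrictDer (transv j l) z)) := by
  convert hz.conj_transv h using 1
  funext k
  rcases eq_or_ne k i with rfl | hk
  · simp [hj.symm]
  · simp [hk, hl]

theorem exists_notMem_of_card_lt (s : Finset (Fin n)) (h : s.card < n) : ∃ a, a ∉ s := by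
  by_contra! hs
  have := Finset.card_le_card (fun a _ => hs a : Finset.univ ⊆ s)
  rw [Finset.card_univ, Fintype.card_fin] at this
  omega

theorem tameTuple_single_add_swap {i j k p : Fin n} (hji : j ≠ i) (hki : k ≠ i) (hpi : p ≠ i)
    (hjk : j ≠ k) (hjp : j ≠ p) (hkp : k ≠ p) (q : U) :
    TameTuple (Pi.single i (q • ((X p : U) • brk j k + (X j : U) • brk p k) : D)) := by
  obtain ⟨r, rfl⟩ := transvPoly_surjective (K := K) hjp.symm q
  have h := (tameTuple_single_X (n := n) hpi hji hki hji hjp hkp hjp r).conj_transv_single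
    hjp.symm hji hpi
  have hX : (transvPoly j p (X j) : U) = X j + X p := by simp [transvPoly]
  rw [transv_smul, transv_smul, transv_brk hjk.symm, hX] at h
  have h1 := h.add_single
    (tameTuple_single_X (n := n) hpi hji hki hji hjp hkp hjp (-transvPoly j p r))
    (by simp [hji, hki])
  have h2 := h1.add_single
    (tameTuple_single_X (n := n) hji hpi hki hpi hjp.symm hjk.symm hjp.symm (-transvPoly j p r))
    (by simp [hpi, hki])
  convert h2 using 2
  module

theorem tameTuple_single_of_ne (hK : (4 ≤ n ∧ ringChar K ≠ 3) ∨ 5 ≤ n) {i j k p : Fin n}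
    (hji : j ≠ i) (hki : k ≠ i) (hpi : p ≠ i) (hjk : j ≠ k) (hjp : j ≠ p) (hkp : k ≠ p) (q : U) :
    TameTuple (Pi.single i (q • (X p : U) • brk j k : D)) := by
  rcases hK with ⟨-, hK⟩ | hn
  · have h3 : (3 : K) ≠ 0 := fun h => hK <| by
      have : ringChar K ∣ 3 := ringChar.dvd (by exact_mod_cast h)
      rcases (Nat.dvd_prime Nat.prime_three).1 this with h1 | h1
      · exact absurd h1 (CharP.ringChar_ne_one)
      · exact h1
    obtain ⟨t, rfl⟩ : ∃ t : U, t + t + t = q := by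
      refine ⟨C 3⁻¹ * q, ?_⟩
      have : (C 3⁻¹ * 3 : U) = 1 := by
        rw [show (3 : U) = C 3 from (map_ofNat C 3).symm, ← C_mul, inv_mul_cancel₀ h3, C_1]
      linear_combination q * this
    have h := (tameTuple_single_add_swap hji hki hpi hjk hjp hkp t).add_single
      (tameTuple_single_add_swap hki hji hpi hjk.symm hkp hjp (-t)) (by simp [hji, hki, hpi])
    convert h using 2
    have h1 : (brk k j : D) = -brk j k := brk_skew _ _
    have h2 : (brk p j : D) = -brk j p := brk_skew _ _
    have h3 := brk_jacobi (K := K) j k p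
    have h4 : (brk p k : D) = -brk k p := brk_skew _ _
    rw [h1, h4, ← sub_eq_zero]
    rw [← smul_zero t, ← h3]
    module
  · obtain ⟨l, hl⟩ := exists_notMem_of_card_lt {i, j, k, p}
      (Finset.card_le_four.trans_lt hn)
    simp only [Finset.mem_insert, Finset.mem_singleton, not_or] at hl
    exact tameTuple_single_X hl.1 hji hki hpi (Ne.symm hl.2.1) (Ne.symm hl.2.2.1)
      (Ne.symm hl.2.2.2) q

theorem TameTuple.add {f g : Fin n → D} (hf : TameTuple f) (hg : TameTuple g)
    (hfg : ∀ i, iaDer f (g i) = g i) : TameTuple (f + g) := by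
  have := hf.comp hg
  rwa [show iaDer f ∘ g = g from funext hfg] at this

theorem tameTuple_pair {a b c d : Fin n} (hab : a ≠ b) (hac : a ≠ c) (had : a ≠ d) (hbc : b ≠ c)
    (hbd : b ≠ d) (hcd : c ≠ d) (q : U) :
    TameTuple (Pi.single a ((q * X a * X c * X d) • brk a b) +
      Pi.single b ((q * X b * X c * X d) • brk a b) : Fin n → D) := by
  let P (r : U) (f : D) : Fin n → D :=
    Pi.single a ((r * X a * X c) • f) + Pi.single b ((r * X b * X c) • f)
  have hP (m : Fin n → D) (r : U) (f : D) : iaDer m ∘ P r f = P r (iaDer m f) := by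
    funext i
    simp only [P, Function.comp_apply, Pi.add_apply, map_add, ← map_smul]
    exact congrArg₂ (· + ·) (congrFun (iaDer_comp_single m a _) i)
      (congrFun (iaDer_comp_single m b _) i)
  set s : D := brk c d with hs
  set w : D := brk a b with hw
  have hPs (r : U) : TameTuple (P r s) := by
    have ha := tameTuple_single_X (n := n) hab.symm hac.symm had.symm hac.symm hbc.symm hbd.symm
      hbc.symm (r * X a)
    have hb := tameTuple_single_X (n := n) hab hbc.symm hbd.symm hbc.symm hac.symm had.symm
      hac.symm (r * X b)
    rw [smul_smul] at ha hb
    refine ha.add hb fun i => ?_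
    rcases eq_or_ne i b with rfl | hi
    · simp [hs, hac.symm, had.symm]
    · simp [hi]
  have hδ (r : U) (hr : r ∈ supported K {c}ᶜ) : TameTuple (Pi.single c (r • w)) :=
    tameTuple_single hac hbc hr
  have h1 := (hδ 1 (one_mem _)).comp (hPs q)
  have e1 : iaDer (Pi.single c ((1 : U) • w)) s = s + (X d : U) • w := by
    simp [hs, hcd.symm]
  rw [hP, e1] at h1
  have h2 := h1.comp (hδ (-1) (neg_mem (one_mem _)))
  have e2 : iaDer (Pi.single c ((1 : U) • w) + P q (s + (X d : U) • w)) ((-1 : U) • w) =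
      (-1 : U) • w := by
    simp only [hw, map_smul, iaDer_brk, P, Pi.add_apply, Pi.single_eq_same, Pi.single_eq_of_ne hac,
      Pi.single_eq_of_ne hbc, Pi.single_eq_of_ne hab, Pi.single_eq_of_ne hab.symm]
    module
  rw [iaDer_comp_single, e2, add_right_comm, ← Pi.single_add, ← add_smul, add_neg_cancel, zero_smul,
    Pi.single_zero, zero_add] at h2
  have h3 := h2.comp (hPs (-q))
  have e3 : iaDer (P q (s + (X d : U) • w)) s = s := by
    simp [hs, P, hac.symm, hbc.symm, had.symm, hbd.symm]
  rw [hP, e3] at h3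
  convert h3 using 1
  rw [add_add_add_comm, ← Pi.single_add, ← Pi.single_add]
  congr 2 <;> module

theorem tameTuple_exp_of_ne (hK : (4 ≤ n ∧ ringChar K ≠ 3) ∨ 5 ≤ n) {a b c d : Fin n} (hab : a ≠ b)
    (hac : a ≠ c) (had : a ≠ d) (hbc : b ≠ c) (hbd : b ≠ d) (hcd : c ≠ d) (q : U) :
    TameTuple fun i => (X i : U) • q • (X c : U) • (X d : U) • (brk a b : D) := by
  set z : D := q • (X c : U) • (X d : U) • (brk a b : D) with hz
  have key (S : Finset (Fin n)) :
      TameTuple fun i => if i = a ∨ i = b ∨ i ∈ S then (X i : U) • z else 0 := by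
    induction S using Finset.induction_on with
    | empty =>
      convert tameTuple_pair (n := n) hab hac had hbc hbd hcd q using 1
      funext i
      rcases eq_or_ne i a with rfl | hi
      · simp [hab, hz]
        module
      · rcases eq_or_ne i b with rfl | hi'
        · simp [hi, hz]
          module
        · simp [hi, hi']
    | insert i S hi hS =>
      by_cases hi' : i = a ∨ i = b
      · convert hS using 1
        funext j
        refine if_congr ?_ rfl rfl
        rw [Finset.mem_insert]
        refine ⟨?_, by tauto⟩
        rintro (h | h | rfl | h) <;> tauto
      · push Not at hi'
        have hi : TameTuple (Pi.single i ((X i : U) • z)) := by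
          rcases eq_or_ne i c with rfl | hic
          · convert tameTuple_single_of_ne hK hac hbc hcd.symm hab had hbd (X i * q * X i) using 2
            rw [hz]
            module
          · convert tameTuple_single_of_ne hK hi'.1.symm hi'.2.symm hic.symm hab hac hbc
              (X i * q * X d) using 2
            rw [hz]
            module
        convert hS.comp hi using 1
        have : iaDer (fun i => if i = a ∨ i = b ∨ i ∈ S then (X i : U) • z else 0)
            ((X i : U) • z) = (X i : U) • z := by
          conv_lhs => rw [hz]
          simp only [map_smul, iaDer_brk, true_or, or_true, if_true]
          rw [hz]
          module
        rw [iaDer_comp_single, this]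
        funext j
        rcases eq_or_ne j i with rfl | hj
        · simp [*]
        · simp [hj]
  simpa using key Finset.univ

/-- The element `z` of the derived ideal is exponentially tame if `xᵢ ↦ xᵢ + ⁅z, xᵢ⁆` is a tame
automorphism. -/
def ExpTame (z : D) : Prop := TameTuple fun i => (X i : U) • z

theorem iaDer_exp (z w : D) : iaDer (fun i => (X i : U) • z) w = w := by
  suffices iaDer (fun i => (X i : U) • z) = LinearMap.id from LinearMap.congr_fun this w
  refine LinearMap.ext_on span_brk ?_
  rintro _ ⟨⟨i, j⟩, rfl⟩
  simp only [iaDer_brk, LinearMap.id_apply]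
  module

theorem ExpTame.add {z w : D} (hz : ExpTame z) (hw : ExpTame w) : ExpTame (z + w) := by
  unfold ExpTame
  convert TameTuple.add hz hw fun _ => iaDer_exp _ _ using 1
  funext i
  exact smul_add _ _ _

theorem ExpTame.conj_transv {j l : Fin n} (h : l ≠ j) {z : D} (hz : ExpTame z) :
    ExpTame (restrictDer (transv j l) z) := by
  unfold ExpTame
  convert TameTuple.conj_transv h hz using 1
  funext k
  have hX : transvPoly j l (X k - if k = j then X l else 0 : U) = X k := by
    by_cases hk : k = j <;> simp [transvPoly, hk, h]
  rw [← hX, ← transv_smul, sub_smul, ite_smul, zero_smul, hX]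

theorem expTame_smul_transvPoly {a b j l : Fin n} (h : l ≠ j) (ha : a ≠ j) (hb : b ≠ j) {p : U}
    (hp : ∀ q : U, ExpTame (q • p • (brk a b : D))) (q : U) :
    ExpTame (q • transvPoly j l p • (brk a b : D)) := by
  obtain ⟨r, rfl⟩ := transvPoly_surjective (K := K) h q
  have := (hp r).conj_transv h
  rwa [transv_smul, transv_smul, transv_brk_of_ne ha hb] at this

theorem expTame_smul_X_X_brk (hK : (4 ≤ n ∧ ringChar K ≠ 3) ∨ 5 ≤ n) {a b : Fin n} (hab : a ≠ b)
    (e f : Fin n) (q : U) : ExpTame (q • (X e * X f : U) • (brk a b : D)) := by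
  have hn : 4 ≤ n := by omega
  obtain ⟨c, hc⟩ := exists_notMem_of_card_lt {a, b} (Finset.card_le_two.trans_lt (by omega))
  obtain ⟨d, hd⟩ := exists_notMem_of_card_lt {a, b, c} (Finset.card_le_three.trans_lt (by omega))
  simp only [Finset.mem_insert, Finset.mem_singleton, not_or] at hc hd
  have hac : a ≠ c := Ne.symm hc.1
  have had : a ≠ d := Ne.symm hd.1
  have hbc : b ≠ c := Ne.symm hc.2
  have hbd : b ≠ d := Ne.symm hd.2.1
  have hcd : c ≠ d := Ne.symm hd.2.2
  have hsub {p p' : U} (hp : ∀ q : U, ExpTame (q • (p + p') • (brk a b : D)))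
      (hp' : ∀ q : U, ExpTame (q • p • (brk a b : D))) (q : U) :
      ExpTame (q • p' • (brk a b : D)) := by
    convert (hp q).add (hp' (-q)) using 1
    module
  have h1 (q : U) : ExpTame (q • (X c * X d : U) • (brk a b : D)) := by
    rw [mul_smul]
    exact tameTuple_exp_of_ne hK hab hac had hbc hbd hcd q
  have h2 (e : Fin n) (q : U) : ExpTame (q • (X e * X d : U) • (brk a b : D)) := by
    rcases eq_or_ne e c with rfl | he
    · exact h1 q
    · refine hsub (fun q => ?_) h1 q
      convert expTame_smul_transvPoly he hac hbc h1 q using 3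
      simp [transvPoly, hcd.symm, add_mul]
  rcases eq_or_ne f d with rfl | hf
  · exact h2 e q
  rcases eq_or_ne e d with rfl | he
  · rw [mul_comm]
    exact h2 f q
  · refine hsub (fun q => ?_) (h2 e) q
    convert expTame_smul_transvPoly hf had hbd (h2 e) q using 3
    simp [transvPoly, he, mul_add]

variable (K n) in
/-- The submodule of the derived ideal spanned by all Lie monomials of degree at least four. -/
def derFour : Submodule (MvPolynomial (Fin n) K) (Der K n) :=
  Submodule.span _ (Set.range fun p : (Fin n × Fin n) × Fin n × Fin n =>
    (X p.1.1 * X p.1.2 : U) • brk p.2.1 p.2.2)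

theorem expTame_of_mem_derFour (hK : (4 ≤ n ∧ ringChar K ≠ 3) ∨ 5 ≤ n) {z : D}
    (hz : z ∈ derFour K n) : ExpTame z := by
  suffices ∀ q : U, ExpTame (q • z) by simpa using this 1
  have h0 : ExpTame (0 : D) := by
    have := (expTame_smul_X_X_brk hK (a := ⟨0, by omega⟩) (b := ⟨1, by omega⟩) (by simp)
      ⟨0, by omega⟩ ⟨0, by omega⟩ 0)
    rwa [zero_smul] at this
  induction hz using Submodule.span_induction with
  | mem x hx =>
    obtain ⟨⟨⟨e, f⟩, a, b⟩, rfl⟩ := hx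
    intro q
    rcases eq_or_ne a b with rfl | hab
    · simpa using h0
    · exact expTame_smul_X_X_brk hK hab e f q
  | zero => simpa using h0
  | add x y _ _ hx hy => exact fun q => by rw [smul_add]; exact (hx q).add (hy q)
  | smul c x _ hx => exact fun q => by rw [smul_smul]; exact hx _

variable (K n) in
/-- The `K`-span of all Lie monomials of degree two and three. -/
def derLow : Submodule K (Der K n) :=
  Submodule.span K (Set.range fun p : Fin n × Fin n => (brk p.1 p.2 : D)) ⊔
    Submodule.span K (Set.range fun p : Fin n × Fin n × Fin n =>
      ((X p.1 : U) • brk p.2.1 p.2.2 : D))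

theorem mem_derLow_sup_derFour (z : D) : z ∈ derLow K n ⊔ (derFour K n).restrictScalars K := by
  set N := derLow K n ⊔ (derFour K n).restrictScalars K
  have h2 (q : U) (c d a b : Fin n) : q • (X d : U) • (X c : U) • (brk a b : D) ∈ N := by
    rw [smul_smul (X d)]
    exact Submodule.mem_sup_right (Submodule.smul_mem (derFour K n) q
      (Submodule.subset_span ⟨((d, c), a, b), rfl⟩))
  have h1 (q : U) (c a b : Fin n) : q • (X c : U) • (brk a b : D) ∈ N := by
    induction q using MvPolynomial.induction_on with
    | C r =>
      rw [C_smul]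
      exact Submodule.smul_mem _ _ (Submodule.mem_sup_left (Submodule.mem_sup_right
        (Submodule.subset_span ⟨(c, a, b), rfl⟩)))
    | add p q hp hq => rw [add_smul]; exact add_mem hp hq
    | mul_X p i hp => rw [mul_smul]; exact h2 _ _ _ _ _
  have h0 (q : U) (a b : Fin n) : q • (brk a b : D) ∈ N := by
    induction q using MvPolynomial.induction_on with
    | C r =>
      rw [C_smul]
      exact Submodule.smul_mem _ _ (Submodule.mem_sup_left (Submodule.mem_sup_left
        (Submodule.subset_span ⟨(a, b), rfl⟩)))
    | add p q hp hq => rw [add_smul]; exact add_mem hp hq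
    | mul_X p i hp => rw [mul_smul]; exact h1 _ _ _ _
  suffices ∀ q : U, q • z ∈ N by simpa using this 1
  have hz : z ∈ Submodule.span U (Set.range fun p : Fin n × Fin n => (brk p.1 p.2 : D)) := by
    rw [span_brk]; exact Submodule.mem_top
  induction hz using Submodule.span_induction with
  | mem x hx => obtain ⟨p, rfl⟩ := hx; exact fun q => h0 q _ _
  | zero => simp
  | add x y _ _ hx hy => exact fun q => by rw [smul_add]; exact add_mem (hx q) (hy q)
  | smul c x _ hx => exact fun q => by rw [smul_smul]; exact hx _

open TensorProduct in
theorem baseChange_lie_lie_lie {A L : Type} [CommRing A] [Algebra K A] [LieRing L] [LieAlgebra K L]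
    (hL : ∀ a b c d : L, ⁅⁅a, b⁆, ⁅c, d⁆⁆ = 0) (a b c d : A ⊗[K] L) : ⁅⁅a, b⁆, ⁅c, d⁆⁆ = 0 := by
  induction a with
  | zero => simp
  | add a a' h h' => rw [add_lie, add_lie, h, h', add_zero]
  | tmul r a =>
  induction b with
  | zero => simp
  | add a a' h h' => rw [lie_add, add_lie, h, h', add_zero]
  | tmul s b =>
  induction c with
  | zero => simp
  | add a a' h h' => rw [add_lie, lie_add, h, h', add_zero]
  | tmul t c =>
  induction d with
  | zero => simp
  | add a a' h h' => rw [lie_add, lie_add, h, h', add_zero]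
  | tmul u d =>
    simp only [LieAlgebra.ExtendScalars.bracket_tmul, hL, tmul_zero]

open TensorProduct in
variable (K n) in
/-- The coaction `x ↦ X ^ k ⊗ x`, for `x` homogeneous of degree `k`, describing the grading. -/
def coact : FreeMetabelianLie K n →ₗ⁅K⁆ Polynomial K ⊗[K] FreeMetabelianLie K n :=
  lift (baseChange_lie_lie_lie lie_lie_lie) fun i => Polynomial.X ⊗ₜ xg K n i

open TensorProduct in
theorem coact_of_mem_span {k : ℕ} {m : M} (hm : m ∈ Submodule.span K (monoSet K n k)) :
    coact K n m = (Polynomial.X ^ (k + 1) : Polynomial K) ⊗ₜ[K] m := by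
  induction hm using Submodule.span_induction with
  | mem x hx =>
    induction k generalizing x with
    | zero => obtain ⟨i, rfl⟩ := hx; simp [coact]
    | succ k ih =>
      obtain ⟨u, hu, i, rfl⟩ := hx
      rw [LieHom.map_lie, ih u hu, coact, lift_xg, LieAlgebra.ExtendScalars.bracket_tmul,
        ← pow_succ]
  | zero => simp
  | add x y _ _ hx hy => rw [map_add, hx, hy, tmul_add]
  | smul c x _ hx => rw [map_smul, hx, tmul_smul]

open TensorProduct in
/-- The projection to the homogeneous component of degree `k`. -/
def proj (k : ℕ) : M →ₗ[K] M :=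
  (TensorProduct.lid K M : K ⊗[K] M →ₗ[K] M) ∘ₗ
    (Polynomial.lcoeff K k).rTensor M ∘ₗ (coact K n : M →ₗ[K] Polynomial K ⊗[K] M)

theorem proj_of_mem {k j : ℕ} (hj : 1 ≤ j) {m : M} (hm : m ∈ gradePiece K n j) :
    proj k m = if k = j then m else 0 := by
  have : proj k m = TensorProduct.lid K M ((Polynomial.lcoeff K k).rTensor M (coact K n m)) := rfl
  rw [this, coact_of_mem_span hm, Nat.sub_add_cancel hj]
  simp [Polynomial.coeff_X_pow]

theorem lie_mem_gradePiece {k : ℕ} (hk : 1 ≤ k) {m : M} (hm : m ∈ gradePiece K n k) (i : Fin n) :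
    ⁅m, xg K n i⁆ ∈ gradePiece K n (k + 1) := by
  obtain ⟨k, rfl⟩ := Nat.exists_eq_add_of_le' hk
  change m ∈ Submodule.span K (monoSet K n k) at hm
  change _ ∈ Submodule.span K (monoSet K n (k + 1))
  induction hm using Submodule.span_induction with
  | mem x hx => exact Submodule.subset_span ⟨x, hx, i, rfl⟩
  | zero => simp
  | add x y _ _ hx hy => rw [add_lie]; exact add_mem hx hy
  | smul c x _ hx => rw [smul_lie]; exact Submodule.smul_mem _ _ hx

theorem brk_mem_gradePiece (i j : Fin n) : ((brk i j : D) : M) ∈ gradePiece K n 2 :=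
  Submodule.subset_span ⟨_, ⟨i, rfl⟩, j, rfl⟩

variable (K n) in
/-- The sum of all homogeneous components of degree at least `d`. -/
abbrev gradeGE (d : ℕ) : Submodule K (FreeMetabelianLie K n) :=
  ⨆ (k : ℕ) (_ : d ≤ k), gradePiece K n k

theorem gradePiece_le_gradeGE {d k : ℕ} (h : d ≤ k) : gradePiece K n k ≤ gradeGE K n d :=
  le_iSup₂_of_le k h le_rfl

theorem gradeGE_antitone : Antitone (gradeGE K n) := fun _ _ h =>
  iSup₂_le fun _ hk => gradePiece_le_gradeGE (h.trans hk)

theorem lie_mem_gradeGE {d : ℕ} (hd : 1 ≤ d) {m : M} (hm : m ∈ gradeGE K n d) (i : Fin n) :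
    ⁅m, xg K n i⁆ ∈ gradeGE K n (d + 1) := by
  let f : M →ₗ[K] M := -LieAlgebra.ad K M (xg K n i)
  have hf (m : M) : f m = ⁅m, xg K n i⁆ := lie_skew m (xg K n i)
  have : gradeGE K n d ≤ (gradeGE K n (d + 1)).comap f := iSup₂_le fun k hk m hm => by
    rw [Submodule.mem_comap, hf]
    exact gradePiece_le_gradeGE (Nat.succ_le_succ hk) (lie_mem_gradePiece (hd.trans hk) hm i)
  rw [← hf]
  exact this hm

theorem proj_of_mem_gradeGE {d k : ℕ} (hd : 1 ≤ d) (hk : k < d) {m : M} (hm : m ∈ gradeGE K n d) :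
    proj k m = 0 := by
  have : gradeGE K n d ≤ (proj k : M →ₗ[K] M).ker := iSup₂_le fun j hj m hm => by
    rw [LinearMap.mem_ker, proj_of_mem (hd.trans hj) hm, if_neg (by omega)]
  exact this hm

theorem coe_mem_gradeGE_of_mem_derFour {z : D} (hz : z ∈ derFour K n) :
    (z : M) ∈ gradeGE K n 4 := by
  suffices ∀ q : U, ((q • z : D) : M) ∈ gradeGE K n 4 by simpa using this 1
  induction hz using Submodule.span_induction with
  | mem x hx =>
    obtain ⟨⟨⟨e, f⟩, a, b⟩, rfl⟩ := hx
    intro q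
    induction q using MvPolynomial.induction_on with
    | C r =>
      rw [C_smul]
      refine Submodule.smul_mem _ r (gradePiece_le_gradeGE le_rfl ?_)
      dsimp only
      rw [mul_smul, coe_X_smul, coe_X_smul]
      exact lie_mem_gradePiece (by norm_num)
        (lie_mem_gradePiece (by norm_num) (brk_mem_gradePiece a b) f) e
    | add p q hp hq => rw [add_smul]; exact add_mem hp hq
    | mul_X p i hp =>
      rw [mul_comm, mul_smul, coe_X_smul]
      exact gradeGE_antitone (Nat.le_succ 4) (lie_mem_gradeGE (by norm_num) hp i)
  | zero => simp
  | add x y _ _ hx hy => exact fun q => by rw [smul_add]; exact add_mem (hx q) (hy q)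
  | smul c x _ hx => exact fun q => by rw [smul_smul]; exact hx _

theorem coe_mem_of_mem_derLow {z : D} (hz : z ∈ derLow K n) :
    (z : M) ∈ gradePiece K n 2 ⊔ gradePiece K n 3 := by
  have : derLow K n ≤
      (gradePiece K n 2 ⊔ gradePiece K n 3).comap (LieSubmodule.incl D : D →ₗ[K] M) := by
    refine sup_le (Submodule.span_le.2 ?_) (Submodule.span_le.2 ?_)
    · rintro _ ⟨p, rfl⟩
      exact Submodule.mem_sup_left (brk_mem_gradePiece _ _)
    · rintro _ ⟨p, rfl⟩
      refine Submodule.mem_sup_right ?_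
      have := lie_mem_gradePiece (by norm_num) (brk_mem_gradePiece (K := K) p.2.1 p.2.2) p.1
      rwa [← coe_X_smul] at this
  exact this hz

theorem lie_eq_zero_of_proj {z : M} (hz : z ∈ gradePiece K n 2 ⊔ gradePiece K n 3) (i : Fin n)
    (h3 : proj 3 ⁅z, xg K n i⁆ = 0) (h4 : proj 4 ⁅z, xg K n i⁆ = 0) : ⁅z, xg K n i⁆ = 0 := by
  obtain ⟨a, ha, b, hb, rfl⟩ := Submodule.mem_sup.1 hz
  have ha' := lie_mem_gradePiece (by norm_num) ha i
  have hb' := lie_mem_gradePiece (by norm_num) hb i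
  rw [add_lie] at h3 h4 ⊢
  rw [map_add, proj_of_mem (by norm_num) ha', proj_of_mem (by norm_num) hb'] at h3 h4
  simp at h3 h4
  rw [h3, h4, add_zero]

end FreeMetabelianLie
end

/-- **Theorem 2.** Over a field `K`, with `n ≥ 4` and `char K ≠ 3`, or `n ≥ 5`, every
exponential automorphism of the free metabelian Lie algebra `Mₙ` of lower degree `≥ 5`
is tame. -/
theorem exponential_aut_ldeg_ge_five_is_tame (K : Type) [Field K] (n : ℕ) (hn : 0 < n)
    (hK : (4 ≤ n ∧ ringChar K ≠ 3) ∨ 5 ≤ n)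
    (φ : FreeMetabelianLie K n ≃ₗ⁅K⁆ FreeMetabelianLie K n)
    (hexp : IsExponentialAut K n φ) (hdeg : AutLdegGE K n φ 5) :
    IsTame K n φ := by
  obtain ⟨z, hz, hφ⟩ := hexp
  obtain ⟨z₀, hz₀, w, hw, hzw⟩ :=
    Submodule.mem_sup.1 (FreeMetabelianLie.mem_derLow_sup_derFour ⟨z, hz⟩)
  have hzw' : (z₀ : FreeMetabelianLie K n) + w = z := congrArg Subtype.val hzw
  refine FreeMetabelianLie.isTame_of_tameTuple
    (FreeMetabelianLie.expTame_of_mem_derFour hK hw) φ fun i => ?_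
  have hx : xg K n i ∈ gradePiece K n 1 := Submodule.subset_span ⟨i, rfl⟩
  have hwi := FreeMetabelianLie.lie_mem_gradeGE (by norm_num)
    (FreeMetabelianLie.coe_mem_gradeGE_of_mem_derFour hw) i
  have hsum : φ (xg K n i) = xg K n i + ⁅(z₀ : FreeMetabelianLie K n), xg K n i⁆ +
      ⁅(w : FreeMetabelianLie K n), xg K n i⁆ := by
    rw [hφ, ← hzw', add_lie, add_assoc]
  have hproj (k : ℕ) (h1 : 1 < k) (h5 : k < 5) :
      FreeMetabelianLie.proj k ⁅(z₀ : FreeMetabelianLie K n), xg K n i⁆ = 0 := by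
    obtain ⟨a, ha, b, hb, hab⟩ := Submodule.mem_sup.1 (hdeg i)
    have h := congrArg (FreeMetabelianLie.proj k) (hab.trans hsum)
    rw [map_add, map_add, map_add, FreeMetabelianLie.proj_of_mem le_rfl ha,
      FreeMetabelianLie.proj_of_mem_gradeGE (by norm_num) h5 hb,
      FreeMetabelianLie.proj_of_mem le_rfl hx,
      FreeMetabelianLie.proj_of_mem_gradeGE (by norm_num) h5 hwi, if_neg h1.ne', if_neg h1.ne',
      zero_add, zero_add, add_zero] at h
    exact h.symm
  rw [hsum, FreeMetabelianLie.lie_eq_zero_of_proj (FreeMetabelianLie.coe_mem_of_mem_derLow hz₀) i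
    (hproj 3 (by norm_num) (by norm_num)) (hproj 4 (by norm_num) (by norm_num)), add_zero,
    FreeMetabelianLie.coe_X_smul]
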